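/- Let p be a prime such that S is p-maximal, and let λ = (l, μ, p^{ν_λ}·m) ∈ L₀^# ∩ P_S with p ∤ m and ν_λ := ν_p(gcd(S₀λ)) (so ν_λ = ν_p of the last component). Put λ* := (p^{ν_λ}·l, μ, m) ∈ L₀^# ∩ P_S, which satisfies ν_p(gcd(S₀λ*)) = 0. Then for every integer ν ≥ 0: N(λ, p^ν, p^{min(ν,ν_λ)}) = N*(λ*, p^ν). -/

import Mathlib

open Matrix Complex

namespace OEis

/-- Extension of an even Gram matrix by a hyperbolic plane:
`[[0,0,1],[0,A,0],[1,0,0]]`. -/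
def hyp {m : ℕ} (A : Matrix (Fin m) (Fin m) ℤ) :
    Matrix (Fin (m + 2)) (Fin (m + 2)) ℤ := fun i j =>
  if hi0 : (i : ℕ) = 0 then (if (j : ℕ) = m + 1 then 1 else 0)
  else if him : (i : ℕ) = m + 1 then (if (j : ℕ) = 0 then 1 else 0)
  else if hj0 : (j : ℕ) = 0 then 0
  else if hjm : (j : ℕ) = m + 1 then 0
  else A ⟨(i : ℕ) - 1, by have := i.isLt; omega⟩ ⟨(j : ℕ) - 1, by have := j.isLt; omega⟩

variable (n : ℕ) (S : Matrix (Fin n) (Fin n) ℤ)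

/-- `S₀ = [[0,0,1],[0,-S,0],[1,0,0]]`. -/
def MatS0 : Matrix (Fin (n + 2)) (Fin (n + 2)) ℤ := hyp (-S)

/-- `S₁ = [[0,0,1],[0,S₀,0],[1,0,0]]`. -/
def MatS1 : Matrix (Fin (n + 4)) (Fin (n + 4)) ℤ := hyp (MatS0 n S)

/-- Bilinear form `uᵀ A v` over a field `K`. -/
def bilin {m : ℕ} (K : Type) [Field K] (A : Matrix (Fin m) (Fin m) ℤ)
    (u v : Fin m → K) : K :=
  u ⬝ᵥ (A.map (Int.cast : ℤ → K)).mulVec v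

/-- Quadratic form `Q_A(v) = vᵀAv/2` over a field `K`. -/
def quadF {m : ℕ} (K : Type) [Field K] (A : Matrix (Fin m) (Fin m) ℤ)
    (v : Fin m → K) : K := bilin K A v v / 2

/-- First component of a vector. -/
def vfirst {m : ℕ} {K : Type} (g : Fin (m + 2) → K) : K := g ⟨0, by omega⟩

/-- Last component of a vector. -/
def vlast {m : ℕ} {K : Type} (g : Fin (m + 2) → K) : K := g ⟨m + 1, by omega⟩

/-- Middle components of a vector. -/
def vmid {m : ℕ} {K : Type} (g : Fin (m + 2) → K) : Fin m → K :=
  fun i => g ⟨(i : ℕ) + 1, by have := i.isLt; omega⟩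

/-- gcd of the entries of a rational vector (via numerators). -/
def ratGcd {m : ℕ} (v : Fin m → ℚ) : ℕ :=
  Finset.gcd Finset.univ fun i => (v i).num.natAbs

/-- `v` has integral entries. -/
def inLat {m : ℕ} (v : Fin m → ℚ) : Prop := ∀ i, ∃ z : ℤ, v i = (z : ℚ)

/-- `g ∈ ℤ^m + c`. -/
def inLatShift {m : ℕ} (c g : Fin m → ℚ) : Prop := ∀ i, ∃ z : ℤ, g i - c i = (z : ℚ)

/-- Membership in the dual lattice `A⁻¹ℤ^m`, i.e. `Av` is integral. -/
def inDual {m : ℕ} (A : Matrix (Fin m) (Fin m) ℤ) (v : Fin m → ℚ) : Prop :=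
  ∀ i, ∃ z : ℤ, ((A.map (Int.cast : ℤ → ℚ)).mulVec v) i = (z : ℚ)

/-- The positive cone `P_S`. -/
def PosCone : Set (Fin (n + 2) → ℝ) :=
  {y | 0 < quadF ℝ (MatS0 n S) y ∧ 0 < y ⟨0, by omega⟩}

/-- The tube domain `H_S`. -/
def HS : Set (Fin (n + 2) → ℂ) :=
  {z | (fun i => (z i).im) ∈ PosCone n S}

/-- Automorphy factor attached to a vector:
`j(g,z) = -γ Q₀(z) + (d,z)₀ + δ` for `g = (δ,dᵀ,γ)ᵀ`. -/
noncomputable def jay (g : Fin (n + 4) → ℚ) (z : Fin (n + 2) → ℂ) : ℂ :=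
  -((vlast g : ℚ) : ℂ) * quadF ℂ (MatS0 n S) z
    + bilin ℂ (MatS0 n S) (fun i => ((vmid g i : ℚ) : ℂ)) z
    + ((vfirst g : ℚ) : ℂ)

/-- The index set of the Eisenstein series attached to a cusp `c`:
`{g ∈ L₁ + c : Q₁(g) = 0, gcd(S₁g) = 1}`. -/
def cuspSet (c : Fin (n + 4) → ℚ) : Set (Fin (n + 4) → ℚ) :=
  {g | inLatShift c g ∧ quadF ℚ (MatS1 n S) g = 0 ∧
    ratGcd (((MatS1 n S).map (Int.cast : ℤ → ℚ)).mulVec g) = 1}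

/-- The standard-form cusp vector `(1, 0, 𝔠ᵀ, 0, Q(𝔠))ᵀ`. -/
def stdCuspVec (fc : Fin n → ℚ) : Fin (n + 4) → ℚ := fun i =>
  if h0 : (i : ℕ) = 0 then 1
  else if h3 : (i : ℕ) = n + 3 then quadF ℚ S fc
  else if h12 : (i : ℕ) = 1 ∨ (i : ℕ) = n + 2 then 0
  else fc ⟨(i : ℕ) - 2, by have := i.isLt; omega⟩

/-- `c` is a standard-form cusp. -/
def IsStdCusp (c : Fin (n + 4) → ℚ) : Prop :=
  ∃ fc : Fin n → ℚ, inDual S fc ∧ (∃ z : ℤ, quadF ℚ S fc = (z : ℚ)) ∧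
    c = stdCuspVec n S fc

/-- The real orthogonal group of `A`. -/
def OSet {m : ℕ} (A : Matrix (Fin m) (Fin m) ℤ) : Set (Matrix (Fin m) (Fin m) ℝ) :=
  {M | Mᵀ * A.map (Int.cast : ℤ → ℝ) * M = A.map (Int.cast : ℤ → ℝ)}

/-- Connected component of the identity in the real orthogonal group. -/
def OPlus {m : ℕ} (A : Matrix (Fin m) (Fin m) ℤ) : Set (Matrix (Fin m) (Fin m) ℝ) :=
  connectedComponentIn (OSet A) 1

/-- `Γ_S`: integral matrices in `O⁺(S₁;ℝ)`. -/
def GammaS : Set (Matrix (Fin (n + 4)) (Fin (n + 4)) ℝ) :=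
  {M | M ∈ OPlus (MatS1 n S) ∧ ∀ i j, ∃ z : ℤ, M i j = (z : ℝ)}

/-- The discriminant kernel `Γ̃_S`. -/
def GammaTilde : Set (Matrix (Fin (n + 4)) (Fin (n + 4)) ℝ) :=
  {M | M ∈ GammaS n S ∧
    ∃ X : Matrix (Fin (n + 4)) (Fin (n + 4)) ℤ,
      M = 1 + (X * MatS1 n S).map (Int.cast : ℤ → ℝ)}

/-- Automorphy factor of a matrix: `j(M,z) = -γ Q₀(z) + (d,z)₀ + δ`
where `(γ, dᵀS₀, δ)` is the bottom row of `M`. -/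
noncomputable def jayM (M : Matrix (Fin (n + 4)) (Fin (n + 4)) ℝ)
    (z : Fin (n + 2) → ℂ) : ℂ :=
  -((M ⟨n + 3, by omega⟩ ⟨0, by omega⟩ : ℝ) : ℂ) * quadF ℂ (MatS0 n S) z
    + ∑ i : Fin (n + 2),
        ((M ⟨n + 3, by omega⟩ ⟨(i : ℕ) + 1, by have := i.isLt; omega⟩ : ℝ) : ℂ) * z i
    + ((M ⟨n + 3, by omega⟩ ⟨n + 3, by omega⟩ : ℝ) : ℂ)

/-- The action `M⟨z⟩ = (-Q₀(z)·b + Kz + c')·j(M,z)⁻¹`. -/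
noncomputable def actM (M : Matrix (Fin (n + 4)) (Fin (n + 4)) ℝ)
    (z : Fin (n + 2) → ℂ) : Fin (n + 2) → ℂ := fun i =>
  (-(quadF ℂ (MatS0 n S) z) *
      ((M ⟨(i : ℕ) + 1, by have := i.isLt; omega⟩ ⟨0, by omega⟩ : ℝ) : ℂ)
    + ∑ j : Fin (n + 2),
        ((M ⟨(i : ℕ) + 1, by have := i.isLt; omega⟩
            ⟨(j : ℕ) + 1, by have := j.isLt; omega⟩ : ℝ) : ℂ) * z j
    + ((M ⟨(i : ℕ) + 1, by have := i.isLt; omega⟩ ⟨n + 3, by omega⟩ : ℝ) : ℂ))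
  * (jayM n S M z)⁻¹

/-- The integral vector `(−Q₀(d)/γ, dᵀ, γ)ᵀ` built from `d` and `γ`. -/
def gExt (d : Fin (n + 2) → ℕ) (γ : ℕ) : Fin (n + 4) → ℚ := fun i =>
  if h0 : (i : ℕ) = 0 then -(quadF ℚ (MatS0 n S) fun j => (d j : ℚ)) / γ
  else if h3 : (i : ℕ) = n + 3 then (γ : ℚ)
  else (d ⟨(i : ℕ) - 1, by have := i.isLt; omega⟩ : ℚ)

open scoped Classical in
/-- The Dirichlet coefficient `a(λ,γ)`. -/
noncomputable def aCoef (lam : Fin (n + 2) → ℚ) (γ : ℕ) : ℂ :=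
  ∑ d ∈ Fintype.piFinset fun _ : Fin (n + 2) => Finset.range γ,
    if (∃ e : ℤ, quadF ℚ (MatS0 n S) (fun j => (d j : ℚ)) = (γ : ℚ) * e) ∧
        ratGcd (((MatS1 n S).map (Int.cast : ℤ → ℚ)).mulVec (gExt n S d γ)) = 1 then
      Complex.exp (2 * Real.pi * Complex.I *
        ((bilin ℚ (MatS0 n S) lam (fun j => (d j : ℚ)) / γ : ℚ) : ℂ))
    else 0

/-- The convolution `b(λ,γ) = Σ_{δ∣γ} a(λ,δ)`. -/
noncomputable def bCoef (lam : Fin (n + 2) → ℚ) (γ : ℕ) : ℂ :=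
  ∑ δ ∈ γ.divisors, aCoef n S lam δ

/-- The order/level of a rational vector: least `N ≥ 1` with `Nv` integral. -/
noncomputable def ordv {m : ℕ} (v : Fin m → ℚ) : ℕ :=
  sInf {N : ℕ | 0 < N ∧ ∀ i, ∃ z : ℤ, (N : ℚ) * v i = (z : ℚ)}

/-- `S` is `p`-maximal. -/
def pMaximal (p : ℕ) : Prop :=
  ∀ v : Fin n → ℚ, inDual S v → (∃ z : ℤ, quadF ℚ S v = (z : ℚ)) → ¬ p ∣ ordv v

/-- The vector `(l, μᵀ, m)ᵀ ∈ ℚ^{n+2}`. -/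
def asmVec (l : ℚ) (μ : Fin n → ℚ) (m : ℚ) : Fin (n + 2) → ℚ := fun i =>
  if h0 : (i : ℕ) = 0 then l
  else if h1 : (i : ℕ) = n + 1 then m
  else μ ⟨(i : ℕ) - 1, by have := i.isLt; omega⟩

open scoped Classical in
/-- The representation number `N(λ, p^ν, p^t)`. -/
noncomputable def Ncount (lam : Fin (n + 2) → ℚ) (p νl ν t : ℕ) : ℕ :=
  ((Fintype.piFinset fun _ : Fin n => Finset.range (p ^ ν)).filter fun v =>
    (∃ e : ℤ, quadF ℚ S (fun i => (v i : ℚ)) = (p : ℚ) ^ (t : ℕ) * e) ∧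
    (∃ e : ℤ, (p : ℚ) ^ ((νl : ℤ) - (t : ℤ)) * quadF ℚ S (fun i => (v i : ℚ))
        - bilin ℚ S (fun i => (v i : ℚ)) (vmid lam)
        + (p : ℚ) ^ ((t : ℤ) - (νl : ℤ)) * lam ⟨0, by omega⟩ * lam ⟨n + 1, by omega⟩
      = (p : ℚ) ^ (ν : ℕ) * e)).card

/-- `N*(λ,p^ν) = Σ_{t=0}^{min(ν,ν_λ)} N(λ,p^ν,p^t)`. -/
noncomputable def Nstar (lam : Fin (n + 2) → ℚ) (p νl ν : ℕ) : ℕ :=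
  ∑ t ∈ Finset.range (min ν νl + 1), Ncount n S lam p νl ν t

/-- Kloosterman sum `K(α,β;γ)` (with `β` allowed rational;
in all uses `β` is an integer). -/
noncomputable def kloos (α : ℤ) (β : ℚ) (γ : ℕ) : ℂ :=
  ∑ j ∈ Finset.range γ,
    if Nat.Coprime j γ then
      Complex.exp (2 * Real.pi * Complex.I *
        ((((α : ℚ) * j + β * ((((j : ZMod γ)⁻¹).val : ℕ) : ℚ)) / γ : ℚ) : ℂ))
    else 0

/-- `q ≡ 0 (mod p^k)` in `ℤ_p`, for a rational `q`. -/
def pCong (p k : ℕ) (q : ℚ) : Prop :=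
  q = 0 ∨ (k : ℤ) ≤ padicValRat p q

/-- The constant `c_{k,S}^• = (2π)^{2k-n/2}/(√(det S)·Γ(k)·Γ(k-n/2))`. -/
noncomputable def ckS (k : ℕ) : ℝ :=
  (2 * Real.pi) ^ ((2 * k : ℝ) - n / 2) /
    (Real.sqrt ((S.det : ℤ) : ℝ) * Real.Gamma (k : ℝ) * Real.Gamma ((k : ℝ) - n / 2))

end OEis

open OEis

section AsmVec

variable {n : ℕ} {S : Matrix (Fin n) (Fin n) ℤ}

lemma asmVec_zero (l : ℚ) (μ : Fin n → ℚ) (m : ℚ) : asmVec n l μ m 0 = l := by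
  simp [asmVec]

lemma asmVec_last (l : ℚ) (μ : Fin n → ℚ) (m : ℚ) :
    asmVec n l μ m (Fin.last (n + 1)) = m := by
  simp [asmVec]

lemma asmVec_castSucc_succ (l : ℚ) (μ : Fin n → ℚ) (m : ℚ) (i : Fin n) :
    asmVec n l μ m i.castSucc.succ = μ i := by
  have := i.isLt.ne
  simp [asmVec, this]

lemma vmid_asmVec (l : ℚ) (μ : Fin n → ℚ) (m : ℚ) : vmid (asmVec n l μ m) = μ :=
  funext fun i => asmVec_castSucc_succ l μ m i

lemma forall_fin_add_two_iff {P : Fin (n + 2) → Prop} :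
    (∀ i, P i) ↔ P 0 ∧ (∀ i : Fin n, P i.castSucc.succ) ∧ P (Fin.last (n + 1)) := by
  rw [Fin.forall_fin_succ, Fin.forall_fin_succ', Fin.succ_last]

lemma sum_fin_add_two (f : Fin (n + 2) → ℚ) :
    ∑ i, f i = f 0 + (∑ i : Fin n, f i.castSucc.succ + f (Fin.last (n + 1))) := by
  rw [Fin.sum_univ_succ, Fin.sum_univ_castSucc, Fin.succ_last]

/-- `S₀` swaps the outer entries and acts by `-S` on the middle ones. -/
lemma MatS0_mulVec_asmVec (l : ℚ) (μ : Fin n → ℚ) (m : ℚ) :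
    ((MatS0 n S).map (Int.cast : ℤ → ℚ)).mulVec (asmVec n l μ m)
      = asmVec n m (-((S.map (Int.cast : ℤ → ℚ)).mulVec μ)) l := by
  rw [funext_iff, forall_fin_add_two_iff]
  refine ⟨?_, fun i => ?_, ?_⟩
  · rw [asmVec_zero, mulVec, dotProduct, sum_fin_add_two, asmVec_last]
    have (j : Fin n) : (j : ℕ) ≠ n := j.isLt.ne
    simp [MatS0, hyp, this]
  · rw [asmVec_castSucc_succ, mulVec, dotProduct, sum_fin_add_two]
    simp only [asmVec_castSucc_succ]
    have (j : Fin n) : (j : ℕ) ≠ n := j.isLt.ne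
    simp [MatS0, hyp, this, mulVec, dotProduct]
  · rw [asmVec_last, mulVec, dotProduct, sum_fin_add_two, asmVec_zero]
    simp [MatS0, hyp]

lemma bilin_MatS0_asmVec (l : ℚ) (μ : Fin n → ℚ) (m : ℚ) :
    bilin ℚ (MatS0 n S) (asmVec n l μ m) (asmVec n l μ m) = 2 * (l * m) - bilin ℚ S μ μ := by
  rw [bilin, MatS0_mulVec_asmVec, dotProduct, sum_fin_add_two]
  simp only [asmVec_castSucc_succ, asmVec_zero, asmVec_last, bilin, dotProduct, Pi.neg_apply,
    mul_neg, Finset.sum_neg_distrib]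
  ring

lemma quadF_real_ratCast {k : ℕ} (A : Matrix (Fin k) (Fin k) ℤ) (v : Fin k → ℚ) :
    quadF ℝ A (fun i => (v i : ℝ)) = (quadF ℚ A v : ℚ) := by
  simp [quadF, bilin, dotProduct, mulVec]

lemma asmVec_mem_PosCone_iff (l : ℚ) (μ : Fin n → ℚ) (m : ℚ) :
    (fun i => ((asmVec n l μ m i : ℚ) : ℝ)) ∈ PosCone n S
      ↔ 0 < (2 * (l * m) - bilin ℚ S μ μ) / 2 ∧ 0 < l := by
  simp only [PosCone, Set.mem_ofPred_eq]
  rw [quadF_real_ratCast, quadF, bilin_MatS0_asmVec, Rat.cast_pos, Rat.cast_pos]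
  exact Iff.rfl

lemma ratGcd_dvd {k : ℕ} (v : Fin k → ℚ) (i : Fin k) : (ratGcd v : ℤ) ∣ (v i).num :=
  Int.natCast_dvd.mpr (Finset.gcd_dvd (Finset.mem_univ i))

/-- The quadratic form of an even lattice is integral. -/
lemma exists_quadF_eq_intCast (heven : ∀ v : Fin n → ℤ, 2 ∣ v ⬝ᵥ S.mulVec v) (v : Fin n → ℕ) :
    ∃ q : ℤ, quadF ℚ S (fun i => (v i : ℚ)) = q := by
  obtain ⟨q, hq⟩ := heven fun i => v i
  refine ⟨q, ?_⟩
  have h : bilin ℚ S (fun i => (v i : ℚ)) (fun i => (v i : ℚ))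
      = (((fun i => (v i : ℤ)) ⬝ᵥ S.mulVec fun i => (v i : ℤ) : ℤ) : ℚ) := by
    simp [bilin, dotProduct, mulVec]
  rw [quadF, h, hq]
  push_cast
  ring

lemma exists_bilin_eq_mul_intCast {μ : Fin n → ℚ} {d : ℤ}
    (hd : ∀ i, ∃ z : ℤ, ((S.map (Int.cast : ℤ → ℚ)).mulVec μ) i = d * z) (v : Fin n → ℕ) :
    ∃ b : ℤ, bilin ℚ S (fun i => (v i : ℚ)) μ = d * b := by
  choose z hz using hd
  refine ⟨∑ i, v i * z i, ?_⟩
  simp only [bilin, dotProduct, hz]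
  push_cast
  rw [Finset.mul_sum]
  exact Finset.sum_congr rfl fun i _ => by ring

end AsmVec

/-- If `p ^ k` divides the linear term, the top-level congruences collapse to a single one. -/
lemma top_congruences_iff {p : ℕ} (hp : p ≠ 0) (k ν : ℕ) (q b l m : ℤ) :
    ((∃ e : ℤ, (q : ℚ) = (p : ℚ) ^ min ν k * e) ∧
      ∃ e : ℤ, (p : ℚ) ^ ((k : ℤ) - (min ν k : ℕ)) * q - (p : ℚ) ^ k * b
        + (p : ℚ) ^ (((min ν k : ℕ) : ℤ) - k) * l * ((p : ℚ) ^ k * m) = (p : ℚ) ^ ν * e) ↔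
    ∃ e : ℤ, (q : ℚ) - (p : ℚ) ^ k * b + (p : ℚ) ^ k * l * m = (p : ℚ) ^ ν * e := by
  have hp' : (p : ℚ) ≠ 0 := Nat.cast_ne_zero.mpr hp
  rcases le_total ν k with h | h
  · obtain ⟨c, rfl⟩ := Nat.exists_eq_add_of_le h
    rw [min_eq_left h]
    have h1 : (((ν + c : ℕ) : ℤ) - (ν : ℕ)) = (c : ℕ) := by push_cast; ring
    have h2 : ((ν : ℤ) - ((ν + c : ℕ) : ℤ)) = -(c : ℕ) := by push_cast; ring
    rw [h1, h2, _root_.zpow_neg, zpow_natCast, pow_add]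
    constructor
    · rintro ⟨⟨e, he⟩, -⟩
      refine ⟨e - p ^ c * b + p ^ c * l * m, ?_⟩
      rw [he]
      push_cast
      ring
    · rintro ⟨e, he⟩
      have hq : (q : ℚ) = (p : ℚ) ^ ν * ((e + p ^ c * b - p ^ c * l * m : ℤ) : ℚ) := by
        push_cast
        linear_combination he
      refine ⟨⟨_, hq⟩, p ^ c * (e + p ^ c * b - p ^ c * l * m) - p ^ c * b + l * m, ?_⟩
      rw [hq]
      push_cast
      field_simp
  · obtain ⟨c, rfl⟩ := Nat.exists_eq_add_of_le h
    rw [min_eq_right h, sub_self, zpow_zero, one_mul, one_mul]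
    constructor
    · rintro ⟨-, e, he⟩
      exact ⟨e, by linear_combination he⟩
    · rintro ⟨e, he⟩
      refine ⟨⟨p ^ c * e + b - l * m, ?_⟩, e, by linear_combination he⟩
      push_cast
      rw [pow_add] at he
      linear_combination he

/-- `N(λ,p^ν,p^{min(ν,ν_λ)}) = N*(λ*,p^ν)` where
`λ* = (p^{ν_λ}l, μ, m)` for `λ = (l,μ,p^{ν_λ}m)`, `p ∤ m`. -/
theorem representation_number_top_eq_Nstar_primitive
    (n : ℕ) (hn : 1 ≤ n) (S : Matrix (Fin n) (Fin n) ℤ)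
    (hsymm : S.IsSymm)
    (hpos : ∀ v : Fin n → ℝ, v ≠ 0 → 0 < bilin ℝ S v v)
    (heven : ∀ v : Fin n → ℤ, 2 ∣ v ⬝ᵥ S.mulVec v)
    (p : ℕ) (hp : p.Prime) (hmax : pMaximal n S p)
    (l : ℤ) (μ : Fin n → ℚ) (hμ : inDual S μ) (m : ℤ) (hm : ¬ (p : ℤ) ∣ m)
    (νl : ℕ)
    (lam : Fin (n + 2) → ℚ)
    (hlamdef : lam = asmVec n (l : ℚ) μ ((p : ℚ) ^ νl * m))
    (hlampos : (fun i => ((lam i : ℚ) : ℝ)) ∈ PosCone n S)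
    (hνl : νl = padicValNat p
      (ratGcd (((MatS0 n S).map (Int.cast : ℤ → ℚ)).mulVec lam))) :
    inDual (MatS0 n S) (asmVec n ((p : ℚ) ^ νl * l) μ (m : ℚ)) ∧
    (fun i => ((asmVec n ((p : ℚ) ^ νl * l) μ (m : ℚ) i : ℚ) : ℝ)) ∈ PosCone n S ∧
    padicValNat p
        (ratGcd (((MatS0 n S).map (Int.cast : ℤ → ℚ)).mulVec
          (asmVec n ((p : ℚ) ^ νl * l) μ (m : ℚ)))) = 0 ∧
    (∀ ν : ℕ,
      Ncount n S lam p νl ν (min ν νl)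
        = Nstar n S (asmVec n ((p : ℚ) ^ νl * l) μ (m : ℚ)) p 0 ν) := by
  subst hlamdef
  have hp0 : (0 : ℚ) < p := Nat.cast_pos.mpr hp.pos
  have hcontent (i : Fin (n + 2)) : (p : ℤ) ^ νl ∣
      ((((MatS0 n S).map (Int.cast : ℤ → ℚ)).mulVec
        (asmVec n (l : ℚ) μ ((p : ℚ) ^ νl * m))) i).num := by
    have h : p ^ νl ∣ ratGcd (((MatS0 n S).map (Int.cast : ℤ → ℚ)).mulVec
        (asmVec n (l : ℚ) μ ((p : ℚ) ^ νl * m))) := by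
      conv_lhs => rw [hνl]
      exact pow_padicValNat_dvd
    exact (by exact_mod_cast h : (p : ℤ) ^ νl ∣ _).trans (ratGcd_dvd _ i)
  have hdvd (i : Fin n) : ∃ z : ℤ,
      ((S.map (Int.cast : ℤ → ℚ)).mulVec μ) i = ((p ^ νl : ℤ) : ℚ) * z := by
    obtain ⟨s, hs⟩ := hμ i
    have h := hcontent i.castSucc.succ
    rw [MatS0_mulVec_asmVec, asmVec_castSucc_succ, Pi.neg_apply, hs, Rat.neg_num, Rat.num_intCast,
      dvd_neg] at h
    obtain ⟨z, rfl⟩ := h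
    exact ⟨z, by rw [hs, Int.cast_mul]⟩
  refine ⟨?_, ?_, ?_, fun ν => ?_⟩
  · rw [inDual, MatS0_mulVec_asmVec, forall_fin_add_two_iff]
    refine ⟨⟨m, asmVec_zero ..⟩, fun i => ?_, p ^ νl * l, ?_⟩
    · obtain ⟨s, hs⟩ := hμ i
      exact ⟨-s, by rw [asmVec_castSucc_succ, Pi.neg_apply, hs, Int.cast_neg]⟩
    · rw [asmVec_last]
      push_cast
      rfl
  · rw [asmVec_mem_PosCone_iff] at hlampos ⊢
    refine ⟨?_, mul_pos (pow_pos hp0 _) hlampos.2⟩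
    convert hlampos.1 using 4
    ring
  · apply padicValNat.eq_zero_of_not_dvd
    intro h
    have h' := (Int.natCast_dvd_natCast.mpr h).trans (ratGcd_dvd _ 0)
    rw [MatS0_mulVec_asmVec, asmVec_zero, Rat.num_intCast] at h'
    exact hm h'
  · rw [Nstar, min_eq_right (Nat.zero_le ν), zero_add, Finset.sum_range_one, Ncount, Ncount]
    congr 1
    ext v
    simp only [Finset.mem_filter]
    refine and_congr_right fun _ => ?_
    obtain ⟨q, hq⟩ := exists_quadF_eq_intCast heven v
    obtain ⟨b, hb⟩ := exists_bilin_eq_mul_intCast hdvd v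
    rw [vmid_asmVec, vmid_asmVec, hq, hb]
    have key := top_congruences_iff hp.ne_zero νl ν q b l m
    have h0 (l : ℚ) (m : ℚ) : asmVec n l μ m ⟨0, by omega⟩ = l := asmVec_zero l μ m
    have h1 (l : ℚ) (m : ℚ) : asmVec n l μ m ⟨n + 1, by omega⟩ = m := asmVec_last l μ m
    simp only [h0, h1]
    push_cast at key ⊢
    rw [key]
    simp
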